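/- arXiv:1711.00769 — 2 statements merged into one kernel-verified Lean document; each statement's English description precedes it below -/
import Mathlib

section
/- For each i ∈ {1,…,n}, the subspace W = ker V* admits the two orthogonal decompositions W = Ṽ_i(W_i) ⊕ W̃_i and W = W_i ⊕ V_i(W̃_i); that is, Ṽ_i(W_i) and W̃_i are mutually orthogonal closed subspaces of W whose orthogonal direct sum is W, and likewise W_i and V_i(W̃_i) are mutually orthogonal closed subspaces of W whose orthogonal direct sum is W. -/
open ContinuousLinearMap Filter Finset

/-- Product of the commuting operators `V i` over a finite index set `s`. -/
noncomputable def opProd {H : Type*} [NormedAddCommGroup H] [InnerProductSpace ℂ H]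
    {n : ℕ} (V : Fin n → H →L[ℂ] H) (hcomm : ∀ i j, Commute (V i) (V j))
    (s : Finset (Fin n)) : H →L[ℂ] H :=
  s.noncommProd V fun a _ b _ _ => hcomm a b

/-- The wandering subspace `ker ((∏_{i ∈ s} V i)^*)`. -/
noncomputable def wSub {H : Type*} [NormedAddCommGroup H] [InnerProductSpace ℂ H] [CompleteSpace H]
    {n : ℕ} (V : Fin n → H →L[ℂ] H) (hcomm : ∀ i j, Commute (V i) (V j))
    (s : Finset (Fin n)) : Submodule ℂ H :=
  LinearMap.ker (ContinuousLinearMap.adjoint (opProd V hcomm s) : H →ₗ[ℂ] H)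

/-- The orthogonal projection of `H` onto `wSub V hcomm s`, as an operator on `H`. -/
noncomputable def wProj {H : Type*} [NormedAddCommGroup H] [InnerProductSpace ℂ H] [CompleteSpace H]
    {n : ℕ} (V : Fin n → H →L[ℂ] H) (hcomm : ∀ i j, Commute (V i) (V j))
    (s : Finset (Fin n)) : H →L[ℂ] H :=
  haveI : CompleteSpace (wSub V hcomm s) :=
    (ContinuousLinearMap.isClosed_ker _).completeSpace_coe
  (wSub V hcomm s).subtypeL ∘L Submodule.orthogonalProjectionOnto (wSub V hcomm s)

/-- The operator `U_i = P_W ∘ V_i + Ṽ_i^*`, which restricts to a unitary on `W`. -/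
noncomputable def Uop {H : Type*} [NormedAddCommGroup H] [InnerProductSpace ℂ H] [CompleteSpace H]
    {n : ℕ} (V : Fin n → H →L[ℂ] H) (hcomm : ∀ i j, Commute (V i) (V j))
    (i : Fin n) : H →L[ℂ] H :=
  (wProj V hcomm Finset.univ) ∘L V i
    + ContinuousLinearMap.adjoint (opProd V hcomm (Finset.univ.erase i))

section Isometry

variable {H : Type*} [NormedAddCommGroup H] [InnerProductSpace ℂ H] [CompleteSpace H]

theorem isClosed_map_of_norm_map (A : H →L[ℂ] H) (hA : ∀ x, ‖A x‖ = ‖x‖) {S : Submodule ℂ H}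
    (hS : IsClosed (S : Set H)) :
    IsClosed ((S.map (A : H →ₗ[ℂ] H) : Submodule ℂ H) : Set H) := by
  have hiso : Isometry A := AddMonoidHomClass.isometry_of_norm A hA
  simpa using hiso.isClosedEmbedding.isClosedMap _ hS

theorem isOrtho_map_ker_adjoint (A : H →L[ℂ] H) (S : Submodule ℂ H) :
    (S.map (A : H →ₗ[ℂ] H)).IsOrtho (LinearMap.ker (adjoint A : H →ₗ[ℂ] H)) := by
  rw [Submodule.isOrtho_iff_inner_eq]
  rintro _ ⟨x, -, rfl⟩ y hy
  have hy' : adjoint A y = 0 := hy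
  rw [ContinuousLinearMap.coe_coe, ← adjoint_inner_right, hy', inner_zero_right]

/-- The kernel of `(A * B)^*` splits as `A (ker B^*) ⊕ ker A^*` when `A` is an isometry. -/
theorem map_ker_adjoint_sup_ker_adjoint (A B : H →L[ℂ] H) (hA : ∀ x, ‖A x‖ = ‖x‖) :
    (LinearMap.ker (adjoint B : H →ₗ[ℂ] H)).map (A : H →ₗ[ℂ] H)
        ⊔ LinearMap.ker (adjoint A : H →ₗ[ℂ] H)
      = LinearMap.ker (adjoint (A * B) : H →ₗ[ℂ] H) := by
  have hAA : ∀ x, adjoint A (A x) = x := fun x =>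
    DFunLike.congr_fun ((ContinuousLinearMap.norm_map_iff_adjoint_comp_self A).mp hA) x
  have hAB : ∀ x, adjoint (A * B) x = adjoint B (adjoint A x) := fun x =>
    DFunLike.congr_fun (adjoint_comp A B) x
  apply le_antisymm
  · refine sup_le ?_ fun x hx => ?_
    · rintro _ ⟨x, hx, rfl⟩
      have hx' : adjoint B x = 0 := hx
      simp [hAB, hAA, hx']
    · have hx' : adjoint A x = 0 := hx
      simp [hAB, hx']
  · intro x hx
    have hx' : adjoint B (adjoint A x) = 0 := (hAB x).symm.trans hx
    refine Submodule.mem_sup.mpr ⟨A (adjoint A x), ⟨adjoint A x, hx', rfl⟩,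
      x - A (adjoint A x), ?_, by abel⟩
    simp [hAA]

end Isometry

section OpProd

variable {H : Type*} [NormedAddCommGroup H] [InnerProductSpace ℂ H] {n : ℕ}
  (V : Fin n → H →L[ℂ] H) (hcomm : ∀ i j, Commute (V i) (V j))

theorem opProd_empty : opProd V hcomm ∅ = 1 :=
  Finset.noncommProd_empty _ _

theorem opProd_singleton (i : Fin n) : opProd V hcomm {i} = V i :=
  Finset.noncommProd_singleton _ _

theorem mul_opProd_erase {s : Finset (Fin n)} {i : Fin n} (hi : i ∈ s) :
    V i * opProd V hcomm (s.erase i) = opProd V hcomm s :=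
  Finset.mul_noncommProd_erase s hi V _

theorem opProd_erase_mul {s : Finset (Fin n)} {i : Fin n} (hi : i ∈ s) :
    opProd V hcomm (s.erase i) * V i = opProd V hcomm s :=
  Finset.noncommProd_erase_mul s hi V _

theorem norm_opProd_apply (hiso : ∀ i x, ‖V i x‖ = ‖x‖) (s : Finset (Fin n)) (x : H) :
    ‖opProd V hcomm s x‖ = ‖x‖ := by
  induction s using Finset.induction_on with
  | empty => rw [opProd_empty, one_apply_eq_self]
  | insert a s ha ih =>
    rw [← mul_opProd_erase V hcomm (Finset.mem_insert_self a s), Finset.erase_insert ha,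
      mul_apply_eq_comp, hiso, ih]

end OpProd

/-- For each `i`, the wandering subspace `W = ker V^*` decomposes orthogonally as
`W = Ṽ_i(W_i) ⊕ W̃_i` and as `W = W_i ⊕ V_i(W̃_i)`. -/
theorem stmt2 {H : Type*} [NormedAddCommGroup H] [InnerProductSpace ℂ H] [CompleteSpace H]
    {n : ℕ} (hn : 2 ≤ n) (V : Fin n → H →L[ℂ] H)
    (hiso : ∀ i x, ‖V i x‖ = ‖x‖) (hcomm : ∀ i j, Commute (V i) (V j))
    (hshift : ∀ x : H,
      Tendsto (fun m : ℕ => ((ContinuousLinearMap.adjoint (opProd V hcomm Finset.univ)) ^ m) x)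
        atTop (nhds 0))
    (i : Fin n) :
    IsClosed ((Submodule.map (opProd V hcomm (Finset.univ.erase i) : H →ₗ[ℂ] H) (wSub V hcomm {i}) : Submodule ℂ H) : Set H) ∧
    (Submodule.map (opProd V hcomm (Finset.univ.erase i) : H →ₗ[ℂ] H) (wSub V hcomm {i})).IsOrtho
      (wSub V hcomm (Finset.univ.erase i)) ∧
    Submodule.map (opProd V hcomm (Finset.univ.erase i) : H →ₗ[ℂ] H) (wSub V hcomm {i})
        ⊔ wSub V hcomm (Finset.univ.erase i) = wSub V hcomm Finset.univ ∧
    IsClosed ((Submodule.map (V i : H →ₗ[ℂ] H) (wSub V hcomm (Finset.univ.erase i)) : Submodule ℂ H) : Set H) ∧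
    (wSub V hcomm {i}).IsOrtho (Submodule.map (V i : H →ₗ[ℂ] H) (wSub V hcomm (Finset.univ.erase i))) ∧
    wSub V hcomm {i} ⊔ Submodule.map (V i : H →ₗ[ℂ] H) (wSub V hcomm (Finset.univ.erase i))
        = wSub V hcomm Finset.univ := by
  have hP := norm_opProd_apply V hcomm hiso (Finset.univ.erase i)
  refine ⟨isClosed_map_of_norm_map _ hP (ContinuousLinearMap.isClosed_ker _),
    isOrtho_map_ker_adjoint _ _, ?_,
    isClosed_map_of_norm_map _ (hiso i) (ContinuousLinearMap.isClosed_ker _), ?_, ?_⟩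
  · unfold wSub
    rw [opProd_singleton, map_ker_adjoint_sup_ker_adjoint _ _ hP,
      opProd_erase_mul V hcomm (Finset.mem_univ i)]
  · unfold wSub
    rw [opProd_singleton]
    exact (isOrtho_map_ker_adjoint _ _).symm
  · unfold wSub
    rw [opProd_singleton, sup_comm, map_ker_adjoint_sup_ker_adjoint _ _ (hiso i),
      mul_opProd_erase V hcomm (Finset.mem_univ i)]
end

section
/- Let S be an invariant subspace of H²(𝔻ⁿ). Then for all i ≠ j the commutator satisfies the operator identity R_i* R_j − R_j R_i* = P_S ∘ M_{z_j} ∘ (I − P_S) ∘ M_{z_i}* restricted to S (as a bounded operator on S). If moreover S has finite codimension in H²(𝔻ⁿ), then R_i* R_j − R_j R_i* is a compact (indeed finite-rank) operator on S. -/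
open ContinuousLinearMap

/-- The `C^*`-algebra generated by a set `R` of operators on a Hilbert space `E`:
the operator-norm closure of the star subalgebra generated by `R`. -/
noncomputable def genCStar {E : Type*} [NormedAddCommGroup E] [InnerProductSpace ℂ E]
    [CompleteSpace E] (R : Set (E →L[ℂ] E)) : Set (E →L[ℂ] E) :=
  ((StarAlgebra.adjoin ℂ R).topologicalClosure : Set (E →L[ℂ] E))

/-- The Hardy space `H²(𝔻ⁿ)` realized as `ℓ²` over multi-indices `Fin n → ℕ`. -/
abbrev PolyHardy (n : ℕ) : Type := lp (fun _ : Fin n → ℕ => ℂ) 2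

/-- The compression `P_S T|_S` of an operator `T` on `H²(𝔻ⁿ)` to a closed subspace `S`. -/
noncomputable def compressS {n : ℕ} (S : Submodule ℂ (PolyHardy n))
    (hS : IsClosed (S : Set (PolyHardy n))) (T : PolyHardy n →L[ℂ] PolyHardy n) :
    ↥S →L[ℂ] ↥S :=
  haveI : CompleteSpace ↥S := hS.completeSpace_coe
  Submodule.orthogonalProjection S ∘L (T ∘L S.subtypeL)

/-- The restriction `T|_S : S → S` of an operator `T` leaving `S` invariant. -/
noncomputable def restrictS {n : ℕ} (S : Submodule ℂ (PolyHardy n))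
    (T : PolyHardy n →L[ℂ] PolyHardy n) (h : ∀ x ∈ S, T x ∈ S) : ↥S →L[ℂ] ↥S :=
  ContinuousLinearMap.codRestrict (T ∘L S.subtypeL) S fun x => h x x.2

/-- The orthogonal projection of `H²(𝔻ⁿ)` onto a closed subspace `S`, as an operator on
`H²(𝔻ⁿ)`. -/
noncomputable def projFull {n : ℕ} (S : Submodule ℂ (PolyHardy n))
    (hS : IsClosed (S : Set (PolyHardy n))) : PolyHardy n →L[ℂ] PolyHardy n :=
  haveI : CompleteSpace ↥S := hS.completeSpace_coe
  S.subtypeL ∘L Submodule.orthogonalProjection S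

/-- The adjoint of an operator on a closed subspace `S` of `H²(𝔻ⁿ)`. -/
noncomputable def adjS {n : ℕ} (S : Submodule ℂ (PolyHardy n))
    (hS : IsClosed (S : Set (PolyHardy n))) (T : ↥S →L[ℂ] ↥S) : ↥S →L[ℂ] ↥S :=
  haveI : CompleteSpace ↥S := hS.completeSpace_coe
  ContinuousLinearMap.adjoint T

/-- The `C^*`-algebra `T(S) ⊆ B(S)` generated by operators `R i` on a closed subspace `S`. -/
noncomputable def TalgGen {n : ℕ} (S : Submodule ℂ (PolyHardy n))
    (hS : IsClosed (S : Set (PolyHardy n))) (R : Fin n → (↥S →L[ℂ] ↥S)) :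
    Set (↥S →L[ℂ] ↥S) :=
  haveI : CompleteSpace ↥S := hS.completeSpace_coe
  genCStar (Set.range R)

/-- The `C^*`-algebra `T(H²(𝔻ⁿ))` generated by the coordinate shifts. -/
noncomputable def TalgFull {n : ℕ} (Mz : Fin n → (PolyHardy n →L[ℂ] PolyHardy n)) :
    Set (PolyHardy n →L[ℂ] PolyHardy n) :=
  genCStar (Set.range Mz)

/-- The adjoint of a compression is the compression of the adjoint. -/
theorem adjS_compressS {n : ℕ} (S : Submodule ℂ (PolyHardy n))
    (hS : IsClosed (S : Set (PolyHardy n))) (T : PolyHardy n →L[ℂ] PolyHardy n) :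
    adjS S hS (compressS S hS T) = compressS S hS (ContinuousLinearMap.adjoint T) := by
  have : CompleteSpace ↥S := hS.completeSpace_coe
  simp only [adjS, compressS, ContinuousLinearMap.adjoint_comp, Submodule.adjoint_subtypeL,
    Submodule.adjoint_orthogonalProjectionOnto, ContinuousLinearMap.comp_assoc]

/-- Compression is multiplicative when the right factor leaves the subspace invariant. -/
theorem compressS_comp_of_invariant {n : ℕ} (S : Submodule ℂ (PolyHardy n))
    (hS : IsClosed (S : Set (PolyHardy n))) (A B : PolyHardy n →L[ℂ] PolyHardy n)
    (hB : ∀ x ∈ S, B x ∈ S) :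
    compressS S hS A ∘L compressS S hS B = compressS S hS (A ∘L B) := by
  have : CompleteSpace ↥S := hS.completeSpace_coe
  ext1 x
  have hx : ((S.orthogonalProjectionOnto (B x) : S) : PolyHardy n) = B x :=
    congrArg Subtype.val (Submodule.orthogonalProjectionOnto_mem_subspace_eq_self ⟨B x, hB x x.2⟩)
  simp [compressS, hx]

/-- The product of two compressions is the compression of `A P_S B`. -/
theorem compressS_comp {n : ℕ} (S : Submodule ℂ (PolyHardy n))
    (hS : IsClosed (S : Set (PolyHardy n))) (A B : PolyHardy n →L[ℂ] PolyHardy n) :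
    compressS S hS A ∘L compressS S hS B = compressS S hS (A ∘L (projFull S hS ∘L B)) :=
  rfl

/-- Compression is additive with respect to differences. -/
theorem compressS_sub {n : ℕ} (S : Submodule ℂ (PolyHardy n))
    (hS : IsClosed (S : Set (PolyHardy n))) (A B : PolyHardy n →L[ℂ] PolyHardy n) :
    compressS S hS (A - B) = compressS S hS A - compressS S hS B := by
  ext1 x
  simp [compressS]

/-- The adjoint of a coordinate shift is the backward shift in that coordinate. -/
theorem adjoint_shift_apply {n : ℕ} {i : Fin n} {T : PolyHardy n →L[ℂ] PolyHardy n}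
    (hT : ∀ (f : PolyHardy n) (k : Fin n → ℕ),
      T f k = if k i = 0 then 0 else f (Function.update k i (k i - 1)))
    (f : PolyHardy n) (k : Fin n → ℕ) :
    ContinuousLinearMap.adjoint T f k = f (Function.update k i (k i + 1)) := by
  have hsingle : T (lp.single 2 k (1 : ℂ)) =
      lp.single 2 (Function.update k i (k i + 1)) (1 : ℂ) := by
    ext m
    rw [hT]
    simp only [lp.single_apply, Pi.single_apply]
    have : (m = Function.update k i (k i + 1)) ↔
        (m i ≠ 0 ∧ Function.update m i (m i - 1) = k) := by
      constructor
      · rintro rfl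
        simp
      · rintro ⟨h, rfl⟩
        simp [Nat.sub_add_cancel (Nat.one_le_iff_ne_zero.mpr h)]
    by_cases h : m i = 0 <;> simp [this, h]
  have h := ContinuousLinearMap.adjoint_inner_right T (lp.single 2 k (1 : ℂ)) f
  rw [hsingle, lp.inner_single_left, lp.inner_single_left] at h
  simpa using h

/-- Distinct coordinate shifts doubly commute. -/
theorem adjoint_shift_comp_shift {n : ℕ} {i j : Fin n} (hij : i ≠ j)
    {A B : PolyHardy n →L[ℂ] PolyHardy n}
    (hA : ∀ (f : PolyHardy n) (k : Fin n → ℕ),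
      A f k = if k i = 0 then 0 else f (Function.update k i (k i - 1)))
    (hB : ∀ (f : PolyHardy n) (k : Fin n → ℕ),
      B f k = if k j = 0 then 0 else f (Function.update k j (k j - 1))) :
    ContinuousLinearMap.adjoint A ∘L B = B ∘L ContinuousLinearMap.adjoint A := by
  ext f k
  simp only [ContinuousLinearMap.comp_apply]
  rw [adjoint_shift_apply hA, hB, hB, adjoint_shift_apply hA,
    Function.update_of_ne hij.symm, Function.update_of_ne hij, Function.update_comm hij]

/-- If `Sᗮ` is finite-dimensional, an operator factoring through `1 - P_S` has finite rank. -/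
theorem finiteDimensional_range_compressS {n : ℕ} (S : Submodule ℂ (PolyHardy n))
    (hS : IsClosed (S : Set (PolyHardy n))) [FiniteDimensional ℂ ↥Sᗮ]
    (A B : PolyHardy n →L[ℂ] PolyHardy n) :
    FiniteDimensional ℂ ↥(LinearMap.range
      (compressS S hS (A ∘L ((1 - projFull S hS) ∘L B))).toLinearMap) := by
  have : CompleteSpace ↥S := hS.completeSpace_coe
  refine Submodule.finiteDimensional_of_le
    (S₂ := LinearMap.range
      (S.orthogonalProjectionOnto ∘L A ∘L Sᗮ.subtypeL : ↥Sᗮ →L[ℂ] ↥S).toLinearMap) ?_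
  rintro _ ⟨x, rfl⟩
  exact ⟨⟨B x - S.starProjection (B x), Submodule.sub_starProjection_mem_orthogonal _⟩, rfl⟩

/-- A bounded operator of finite rank is compact. -/
theorem isCompactOperator_of_finiteDimensional_range {E F : Type*} [NormedAddCommGroup E]
    [NormedSpace ℂ E] [NormedAddCommGroup F] [NormedSpace ℂ F] (T : E →L[ℂ] F)
    [FiniteDimensional ℂ ↥(LinearMap.range T.toLinearMap)] : IsCompactOperator T := by
  have : ProperSpace ↥(LinearMap.range T.toLinearMap) := FiniteDimensional.proper ℂ _
  exact (isCompactOperator_of_locallyCompactSpace_dom T.rangeRestrict).clm_comp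
    (LinearMap.range T.toLinearMap).subtypeL

/-- For an invariant subspace `S` of `H²(𝔻ⁿ)`, the cross-commutator satisfies
`R_i^* R_j − R_j R_i^* = P_S M_{z_j} (I − P_S) M_{z_i}^* |_S`; if moreover `S` has finite
codimension, then this operator is compact (indeed of finite rank). -/
theorem stmt13 {n : ℕ} (hn : 2 ≤ n)
    (Mz : Fin n → (PolyHardy n →L[ℂ] PolyHardy n))
    (hMz : ∀ (i : Fin n) (f : PolyHardy n) (k : Fin n → ℕ),
      Mz i f k = if k i = 0 then 0 else f (Function.update k i (k i - 1)))
    (S : Submodule ℂ (PolyHardy n)) (hS : IsClosed (S : Set (PolyHardy n)))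
    (hinv : ∀ (i : Fin n), ∀ x ∈ S, Mz i x ∈ S) :
    (∀ i j : Fin n, i ≠ j →
      adjS S hS (compressS S hS (Mz i)) ∘L compressS S hS (Mz j)
          - compressS S hS (Mz j) ∘L adjS S hS (compressS S hS (Mz i))
        = compressS S hS
            (Mz j ∘L ((1 - projFull S hS) ∘L ContinuousLinearMap.adjoint (Mz i)))) ∧
    (FiniteDimensional ℂ ↥Sᗮ → ∀ i j : Fin n, i ≠ j →
      IsCompactOperator
        ⇑(adjS S hS (compressS S hS (Mz i)) ∘L compressS S hS (Mz j)
            - compressS S hS (Mz j) ∘L adjS S hS (compressS S hS (Mz i))) ∧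
      FiniteDimensional ℂ
        ↥(LinearMap.range
            (adjS S hS (compressS S hS (Mz i)) ∘L compressS S hS (Mz j)
              - compressS S hS (Mz j) ∘L adjS S hS (compressS S hS (Mz i))).toLinearMap)) := by
  have key : ∀ i j : Fin n, i ≠ j →
      adjS S hS (compressS S hS (Mz i)) ∘L compressS S hS (Mz j)
          - compressS S hS (Mz j) ∘L adjS S hS (compressS S hS (Mz i))
        = compressS S hS
            (Mz j ∘L ((1 - projFull S hS) ∘L ContinuousLinearMap.adjoint (Mz i))) := by
    intro i j hij
    rw [adjS_compressS, compressS_comp_of_invariant S hS _ _ (hinv j),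
      adjoint_shift_comp_shift hij (hMz i) (hMz j), compressS_comp, ← compressS_sub,
      ContinuousLinearMap.sub_comp, ContinuousLinearMap.comp_sub]
    rfl
  refine ⟨key, fun hfin i j hij => ?_⟩
  rw [key i j hij]
  have := finiteDimensional_range_compressS S hS (Mz j) (ContinuousLinearMap.adjoint (Mz i))
  exact ⟨isCompactOperator_of_finiteDimensional_range _, this⟩
end
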